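/- Cylindric summation formula in profile form: let h ≥ 1, let δ=(δ_1,...,δ_h) be a profile, and let Z^1,...,Z^h be alphabets; set Z_-^δ = Σ_{i: δ_i=−1} Z^i and Z_+^δ = Σ_{i: δ_i=1} Z^i. For partitions λ^0,...,λ^h let s_i^δ denote s_{λ^i/λ^{i−1}} if δ_i=1 and s_{λ^{i−1}/λ^i} if δ_i=−1. Then Σ_{λ^0,...,λ^h with λ^0=λ^h} z^{|λ^h|} ∏_{i=1}^h s_i^δ(Z^i) = ∏_{1≤i<j≤h, δ_i>δ_j} Ψ(Z^i,Z^j) · ∏_{k≥1} Ψ(z^k Z_-^δ, Z_+^δ)/(1−z^k), as an identity of formal power series, where z^k X denotes the alphabet X with every variable multiplied by z^k. -/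

import Mathlib

open scoped BigOperators

/-- An integer partition: a weakly decreasing, finitely supported sequence of
nonnegative integers. -/
structure Ptn where
  toFun : ℕ →₀ ℕ
  antitone' : ∀ ⦃i j : ℕ⦄, i ≤ j → toFun j ≤ toFun i

namespace Ptn
/-- the `i`-th part (0-indexed) -/
def part (lam : Ptn) (i : ℕ) : ℕ := lam.toFun i
/-- the size `|λ|` -/
def size (lam : Ptn) : ℕ := lam.toFun.sum fun _ k => k
end Ptn

/-- `HStrip μ λ` means `μ ≺ λ`, i.e. `λ/μ` is a horizontal strip:
`λ_i ≥ μ_i ≥ λ_{i+1}` for all `i`. -/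
def HStrip (mu lam : Ptn) : Prop :=
  ∀ i : ℕ, mu.part i ≤ lam.part i ∧ lam.part (i + 1) ≤ mu.part i
/-- Chains of partitions `μ = c 0 ≺ c 1 ≺ ⋯` stabilizing at `λ`; these encode
semistandard Young tableaux of shape `λ/μ` with entries in `{0, 1, 2, …}`. -/
def IsSchurChain (mu lam : Ptn) (c : ℕ → Ptn) : Prop :=
  c 0 = mu ∧ (∀ i, HStrip (c i) (c (i + 1))) ∧ ∃ N, ∀ i, N ≤ i → c i = lam

/-- the monomial attached to a chain: the variable `X i` records the cells added
at step `i` of the chain -/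
noncomputable def chainWeight {R : Type*} [CommRing R] (X : ℕ → R) (c : ℕ → Ptn) : R :=
  ∏ᶠ i : ℕ, X i ^ ((c (i + 1)).size - (c i).size)

/-- the skew Schur function `s_{λ/μ}(X)` (which is `0` if `μ ⊄ λ`) -/
noncomputable def skewSchur {R : Type*} [CommRing R] [TopologicalSpace R]
    (X : ℕ → R) (lam mu : Ptn) : R :=
  ∑' c : {c : ℕ → Ptn // IsSchurChain mu lam c}, chainWeight X c.1

/-- `Ψ(X,Y) = ∏_{i,j} (1 - x_i y_j)⁻¹` -/
noncomputable def Psi {R : Type*} [CommRing R] [TopologicalSpace R] [Inv R] (X Y : ℕ → R) : R :=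
  ∏' p : ℕ × ℕ, (1 - X p.1 * Y p.2)⁻¹

/-- `Φ(X) = ∏_i (1 - x_i)⁻¹ ∏_{i<j} (1 - x_i x_j)⁻¹` -/
noncomputable def Phi {R : Type*} [CommRing R] [TopologicalSpace R] [Inv R] (X : ℕ → R) : R :=
  (∏' i : ℕ, (1 - X i)⁻¹) * ∏' p : {q : ℕ × ℕ // q.1 < q.2}, (1 - X p.1.1 * X p.1.2)⁻¹
/-- the coefficientwise (product) topology on multivariate formal power series -/
instance (σ : Type*) : TopologicalSpace (MvPowerSeries σ ℚ) :=
  inferInstanceAs (TopologicalSpace ((σ →₀ ℕ) → ℚ))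

/-- the ambient ring: formal power series in the independent variables
`z^{(i)}_n` (`i, n ∈ ℕ`) and `z` -/
abbrev RZ : Type := MvPowerSeries ((ℕ × ℕ) ⊕ Unit) ℚ

/-- the extra formal variable `z` -/
noncomputable def z : RZ := MvPowerSeries.X (Sum.inr ())

/-- the alphabet `Z^i = {z^{(i)}_0, z^{(i)}_1, …}` -/
noncomputable def Za (i n : ℕ) : RZ := MvPowerSeries.X (Sum.inl (i, n))

/-- `Z^δ_- = Σ_{i : δ_i = -1} Z^i`, the union of the alphabets `Z^i` with
`δ_i = -1` (the remaining entries being `0`) -/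
noncomputable def Zminus (h : ℕ) (δ : ℕ → ℤ) : ℕ → RZ :=
  fun n => if δ (n % h + 1) = -1 then Za (n % h + 1) (n / h) else 0

/-- `Z^δ_+ = Σ_{i : δ_i = 1} Z^i`, the union of the alphabets `Z^i` with
`δ_i = 1` (the remaining entries being `0`) -/
noncomputable def Zplus (h : ℕ) (δ : ℕ → ℤ) : ℕ → RZ :=
  fun n => if δ (n % h + 1) = 1 then Za (n % h + 1) (n / h) else 0

/-- `Z = Z^1 + ⋯ + Z^h`, the union of all the alphabets `Z^1, …, Z^h` -/
noncomputable def Zall (h : ℕ) : ℕ → RZ :=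
  fun n => Za (n % h + 1) (n / h)

/-- `δ` is a `±1`-profile on the indices `1, …, h` -/
def IsProfile (h : ℕ) (δ : ℕ → ℤ) : Prop := ∀ i, 1 ≤ i → i ≤ h → δ i = 1 ∨ δ i = -1

open scoped ENNReal
open MvPowerSeries

namespace Ptn

theorem ext_part {a b : Ptn} (h : ∀ i, a.part i = b.part i) : a = b := by
  cases a; cases b
  congr
  exact Finsupp.ext h

theorem part_antitone (a : Ptn) : Antitone a.part := fun _ _ h => a.antitone' h

theorem exists_part_eq_zero (a : Ptn) : ∃ n, a.part n = 0 := by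
  obtain ⟨n, hn⟩ := Infinite.exists_notMem_finset a.toFun.support
  exact ⟨n, by simpa [part] using hn⟩

theorem size_eq_sum_range (a : Ptn) {n : ℕ} (hn : a.part n = 0) :
    a.size = ∑ i ∈ Finset.range n, a.part i := by
  refine Finsupp.sum_of_support_subset _ ?_ _ (by simp)
  intro i hi
  by_contra hin
  have := a.part_antitone (not_lt.mp (by simpa using hin))
  simp [part] at *
  omega

/-- The partition whose parts are the values of an antitone function that vanishes at `n`. -/
noncomputable def ofAntitone (f : ℕ → ℕ) (hf : Antitone f) (n : ℕ) (hn : f n = 0) : Ptn where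
  toFun := Finsupp.onFinset (Finset.range n) f fun i hi => by
    by_contra hin
    have := hf (not_lt.mp (by simpa using hin))
    omega
  antitone' := hf

@[simp]
theorem part_ofAntitone (f : ℕ → ℕ) (hf : Antitone f) (n : ℕ) (hn : f n = 0) (i : ℕ) :
    (ofAntitone f hf n hn).part i = f i := rfl

theorem size_le_of_part_le {a b : Ptn} (h : ∀ i, a.part i ≤ b.part i) : a.size ≤ b.size := by
  obtain ⟨n, hn⟩ := b.exists_part_eq_zero
  rw [b.size_eq_sum_range hn, a.size_eq_sum_range (Nat.le_zero.mp (hn ▸ h n))]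
  exact Finset.sum_le_sum fun i _ => h i

theorem eq_of_part_le_of_size_eq {a b : Ptn} (h : ∀ i, a.part i ≤ b.part i)
    (hs : a.size = b.size) : a = b := by
  refine ext_part fun i => ?_
  obtain ⟨n, hn⟩ := b.exists_part_eq_zero
  have hn' : b.part (n + i + 1) = 0 :=
    Nat.le_zero.mp (hn ▸ b.part_antitone (by omega : n ≤ n + i + 1))
  rw [b.size_eq_sum_range hn', a.size_eq_sum_range (Nat.le_zero.mp (hn' ▸ h _)),
    Finset.sum_eq_sum_iff_of_le fun i _ => h i] at hs
  exact hs i (by simp)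

theorem finite_part_le (b : Ptn) : {a : Ptn | ∀ i, a.part i ≤ b.part i}.Finite := by
  refine Set.Finite.of_finite_image (f := Ptn.toFun) ((Set.finite_Iic b.toFun).subset ?_) ?_
  · rintro _ ⟨a, ha, rfl⟩
    exact ha
  · intro a _ c _ hac
    exact ext_part fun i => DFunLike.congr_fun hac i

end Ptn

namespace HStrip

theorem refl (a : Ptn) : HStrip a a := fun i => ⟨le_rfl, a.part_antitone (Nat.le_succ i)⟩

theorem size_le {a b : Ptn} (h : HStrip a b) : a.size ≤ b.size :=
  Ptn.size_le_of_part_le fun i => (h i).1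

theorem eq_of_size_eq {a b : Ptn} (h : HStrip a b) (hs : a.size = b.size) : a = b :=
  Ptn.eq_of_part_le_of_size_eq (fun i => (h i).1) hs

theorem finite_left (b : Ptn) : {a : Ptn | HStrip a b}.Finite :=
  b.finite_part_le.subset fun _ h i => (h i).1

/-- The `i`-th part of the partition `ν` obtained from `λ`, `μ`, a natural number `k` and `κ` by the
local growth rule. -/
def growthPart (a b : Ptn) (k : ℕ) (d : Ptn) : ℕ → ℕ
  | 0 => max (a.part 0) (b.part 0) + k
  | i + 1 => min (a.part i) (b.part i) + max (a.part (i + 1)) (b.part (i + 1)) - d.part i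

/-- The local growth rule: partitions `ν` with `λ, μ ≺ ν` correspond to pairs of a natural number
and a partition `κ` with `κ ≺ λ, μ`. -/
noncomputable def growthEquiv (a b : Ptn) :
    {c : Ptn // HStrip a c ∧ HStrip b c} ≃ ℕ × {d : Ptn // HStrip d a ∧ HStrip d b} where
  toFun c :=
    (c.1.part 0 - max (a.part 0) (b.part 0),
      ⟨Ptn.ofAntitone
        (fun i => min (a.part i) (b.part i) + max (a.part (i + 1)) (b.part (i + 1))
          - c.1.part (i + 1))
        (antitone_nat_of_succ_le fun i => by
          have h1 := c.2.1 (i + 1)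
          have h2 := c.2.2 (i + 1)
          have h3 := c.2.1 i
          have h4 := c.2.2 i
          have h5 := c.2.1 (i + 2)
          have h6 := c.2.2 (i + 2)
          simp only [add_assoc, Nat.reduceAdd] at *
          omega)
        a.exists_part_eq_zero.choose (by
          have h1 := c.2.1 a.exists_part_eq_zero.choose
          have h2 := c.2.1 (a.exists_part_eq_zero.choose + 1)
          have h3 := c.2.2 (a.exists_part_eq_zero.choose + 1)
          have h0 := a.exists_part_eq_zero.choose_spec
          omega),
        fun i => by
          have h1 := c.2.1 (i + 1)
          have h2 := c.2.2 (i + 1)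
          have h3 := c.2.1 i
          have h4 := c.2.2 i
          simp only [Ptn.part_ofAntitone]
          omega,
        fun i => by
          have h1 := c.2.1 (i + 1)
          have h2 := c.2.2 (i + 1)
          have h3 := c.2.1 i
          have h4 := c.2.2 i
          simp only [Ptn.part_ofAntitone]
          omega⟩)
  invFun p :=
    ⟨Ptn.ofAntitone
      (growthPart a b p.1 p.2.1)
      (antitone_nat_of_succ_le fun i => by
        cases i with
        | zero =>
          have h1 := p.2.2.1 0
          have h2 := p.2.2.2 0
          simp only [growthPart, zero_add] at *
          omega
        | succ i =>
          have h1 := p.2.2.1 i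
          have h2 := p.2.2.2 i
          have h3 := p.2.2.1 (i + 1)
          have h4 := p.2.2.2 (i + 1)
          simp only [growthPart]
          omega)
      (max a.exists_part_eq_zero.choose b.exists_part_eq_zero.choose + 1) (by
        have h1 := a.part_antitone (le_max_left a.exists_part_eq_zero.choose
          b.exists_part_eq_zero.choose)
        have h2 := b.part_antitone (le_max_right a.exists_part_eq_zero.choose
          b.exists_part_eq_zero.choose)
        have h3 := a.exists_part_eq_zero.choose_spec
        have h4 := b.exists_part_eq_zero.choose_spec
        have h5 := a.part_antitone (Nat.le_succ (max a.exists_part_eq_zero.choose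
          b.exists_part_eq_zero.choose))
        have h6 := b.part_antitone (Nat.le_succ (max a.exists_part_eq_zero.choose
          b.exists_part_eq_zero.choose))
        simp only [Nat.succ_eq_add_one, growthPart] at *
        omega),
      fun i => by
        have h1 := p.2.2.1 i
        have h2 := p.2.2.2 i
        cases i with
        | zero =>
          simp only [Ptn.part_ofAntitone, growthPart, zero_add] at *
          omega
        | succ i =>
          have h3 := p.2.2.1 i
          have h4 := p.2.2.2 i
          simp only [Ptn.part_ofAntitone, growthPart]
          omega,
      fun i => by
        have h1 := p.2.2.1 i
        have h2 := p.2.2.2 i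
        cases i with
        | zero =>
          simp only [Ptn.part_ofAntitone, growthPart, zero_add] at *
          omega
        | succ i =>
          have h3 := p.2.2.1 i
          have h4 := p.2.2.2 i
          simp only [Ptn.part_ofAntitone, growthPart]
          omega⟩
  left_inv c := by
    refine Subtype.ext (Ptn.ext_part fun i => ?_)
    cases i with
    | zero =>
      have h1 := c.2.1 0
      have h2 := c.2.2 0
      simp only [Ptn.part_ofAntitone, growthPart, zero_add] at *
      omega
    | succ i =>
      have h1 := c.2.1 (i + 1)
      have h2 := c.2.2 (i + 1)
      have h3 := c.2.1 i
      have h4 := c.2.2 i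
      simp only [Ptn.part_ofAntitone, growthPart]
      omega
  right_inv p := by
    refine Prod.ext ?_ (Subtype.ext (Ptn.ext_part fun i => ?_))
    · simp [growthPart]
    · have h1 := p.2.2.1 i
      have h2 := p.2.2.2 i
      simp only [Ptn.part_ofAntitone, growthPart]
      omega

theorem size_growthEquiv (a b : Ptn) (c : {c : Ptn // HStrip a c ∧ HStrip b c}) :
    c.1.size + (growthEquiv a b c).2.1.size = (growthEquiv a b c).1 + a.size + b.size := by
  obtain ⟨n, hn⟩ := c.1.exists_part_eq_zero
  have hn' : c.1.part (n + 1) = 0 := Nat.le_zero.mp (hn ▸ c.1.part_antitone (Nat.le_succ n))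
  have ha : a.part n = 0 := Nat.le_zero.mp (hn ▸ (c.2.1 n).1)
  have hb : b.part n = 0 := Nat.le_zero.mp (hn ▸ (c.2.2 n).1)
  have hd : (growthEquiv a b c).2.1.part n = 0 :=
    Nat.le_zero.mp (ha ▸ ((growthEquiv a b c).2.2.1 n).1)
  have ha' : a.part (n + 1) = 0 := Nat.le_zero.mp (hn' ▸ (c.2.1 (n + 1)).1)
  have hb' : b.part (n + 1) = 0 := Nat.le_zero.mp (hn' ▸ (c.2.2 (n + 1)).1)
  have hm : ∑ i ∈ Finset.range n, (max (a.part i) (b.part i)) =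
      (∑ i ∈ Finset.range n, max (a.part (i + 1)) (b.part (i + 1))) +
        max (a.part 0) (b.part 0) := by
    rw [← Finset.sum_range_succ' (fun i => max (a.part i) (b.part i)), Finset.sum_range_succ, ha,
      hb]
    simp
  have hd2 : (∑ i ∈ Finset.range n, c.1.part (i + 1)) +
      ∑ i ∈ Finset.range n, (growthEquiv a b c).2.1.part i =
      (∑ i ∈ Finset.range n, min (a.part i) (b.part i)) +
        ∑ i ∈ Finset.range n, max (a.part (i + 1)) (b.part (i + 1)) := by
    rw [← Finset.sum_add_distrib, ← Finset.sum_add_distrib]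
    refine Finset.sum_congr rfl fun i _ => ?_
    have h1 := c.2.1 (i + 1)
    have h2 := c.2.2 (i + 1)
    have h3 := c.2.1 i
    have h4 := c.2.2 i
    simp only [growthEquiv, Equiv.coe_fn_mk, Ptn.part_ofAntitone]
    omega
  have hmm : (∑ i ∈ Finset.range n, min (a.part i) (b.part i)) +
      ∑ i ∈ Finset.range n, max (a.part i) (b.part i) =
      (∑ i ∈ Finset.range n, a.part i) + ∑ i ∈ Finset.range n, b.part i := by
    rw [← Finset.sum_add_distrib, ← Finset.sum_add_distrib]
    exact Finset.sum_congr rfl fun i _ => min_add_max _ _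
  have h0 : c.1.part 0 = (growthEquiv a b c).1 + max (a.part 0) (b.part 0) := by
    have h1 := c.2.1 0
    have h2 := c.2.2 0
    simp only [growthEquiv, Equiv.coe_fn_mk]
    omega
  rw [c.1.size_eq_sum_range hn', Finset.sum_range_succ', Ptn.size_eq_sum_range _ hd,
    a.size_eq_sum_range ha, b.size_eq_sum_range hb, h0]
  omega

end HStrip

section FormalSum

variable {σ ι κ : Type*}

/-- The coefficientwise sum of an arbitrary family of formal power series with coefficients in
`ℝ≥0∞`. -/
noncomputable def formalSum (f : ι → MvPowerSeries σ ℝ≥0∞) : MvPowerSeries σ ℝ≥0∞ :=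
  fun m => ∑' i, coeff m (f i)

@[simp]
theorem coeff_formalSum (f : ι → MvPowerSeries σ ℝ≥0∞) (m : σ →₀ ℕ) :
    coeff m (formalSum f) = ∑' i, coeff m (f i) := rfl

theorem mul_formalSum (a : MvPowerSeries σ ℝ≥0∞) (f : ι → MvPowerSeries σ ℝ≥0∞) :
    a * formalSum f = formalSum fun i => a * f i := by
  classical
  ext m
  simp only [coeff_mul, coeff_formalSum, ← ENNReal.tsum_mul_left]
  exact (Summable.tsum_finsetSum fun _ _ => ENNReal.summable).symm

theorem formalSum_mul (a : MvPowerSeries σ ℝ≥0∞) (f : ι → MvPowerSeries σ ℝ≥0∞) :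
    formalSum f * a = formalSum fun i => f i * a := by
  simp only [mul_comm _ a, mul_formalSum]

theorem formalSum_comm (f : ι → κ → MvPowerSeries σ ℝ≥0∞) :
    (formalSum fun i => formalSum fun j => f i j) =
      formalSum fun j => formalSum fun i => f i j := by
  ext m
  simpa using ENNReal.tsum_comm

theorem formalSum_prod (f : ι × κ → MvPowerSeries σ ℝ≥0∞) :
    formalSum f = formalSum fun i => formalSum fun j => f (i, j) := by
  ext m
  simpa using ENNReal.tsum_prod' (f := fun p => coeff m (f p))

theorem formalSum_equiv (e : ι ≃ κ) (f : κ → MvPowerSeries σ ℝ≥0∞) :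
    (formalSum fun i => f (e i)) = formalSum f := by
  ext m
  simpa using e.tsum_eq fun j => coeff m (f j)

theorem formalSum_eq_single (i : ι) (f : ι → MvPowerSeries σ ℝ≥0∞) (h : ∀ j, j ≠ i → f j = 0) :
    formalSum f = f i := by
  ext m
  simpa using tsum_eq_single (f := fun j => coeff m (f j)) i fun j hj => by simp [h j hj]

theorem formalSum_eq_sum (s : Finset ι) (f : ι → MvPowerSeries σ ℝ≥0∞) (h : ∀ j ∉ s, f j = 0) :
    formalSum f = ∑ i ∈ s, f i := by
  ext m
  simpa using tsum_eq_sum (f := fun j => coeff m (f j)) (s := s) fun j hj => by simp [h j hj]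

theorem formalSum_subtype (p : ι → Prop) (f : ι → MvPowerSeries σ ℝ≥0∞)
    (h : ∀ i, ¬ p i → f i = 0) : (formalSum fun i : {i // p i} => f i) = formalSum f := by
  ext m
  refine tsum_subtype_eq_of_support_subset (f := fun i => coeff m (f i)) (s := {i | p i}) ?_
  intro i hi
  by_contra hp
  exact hi (by simp [h i hp])

/-- The geometric series `∑ t ^ k`. -/
noncomputable def geomSum (t : MvPowerSeries σ ℝ≥0∞) : MvPowerSeries σ ℝ≥0∞ :=
  formalSum fun k : ℕ => t ^ k

end FormalSum

section Kernel

/-- Infinite matrices indexed by partitions, with power series over `ℝ≥0∞` as entries. -/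
def PtnKernel (σ : Type*) : Type _ := Ptn → Ptn → MvPowerSeries σ ℝ≥0∞

namespace PtnKernel

variable {σ : Type*}

@[ext]
theorem ext {P Q : PtnKernel σ} (h : ∀ a b, P a b = Q a b) : P = Q := funext₂ h

open Classical in
noncomputable instance : Monoid (PtnKernel σ) where
  mul P Q := fun a b => formalSum fun c => P a c * Q c b
  one := fun a b => if a = b then 1 else 0
  mul_assoc P Q R := by
    ext1 a b
    change (formalSum fun c => (formalSum fun d => P a d * Q d c) * R c b) =
      formalSum fun d => P a d * formalSum fun c => Q d c * R c b
    simp only [mul_formalSum, formalSum_mul, mul_assoc]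
    exact formalSum_comm _
  one_mul P := by
    ext1 a b
    change (formalSum fun c => (if a = c then 1 else 0) * P c b) = P a b
    rw [formalSum_eq_single a _ fun c hc => by simp [hc.symm]]
    simp
  mul_one P := by
    ext1 a b
    change (formalSum fun c => P a c * (if c = b then 1 else 0)) = P a b
    rw [formalSum_eq_single b _ fun c hc => by simp [hc]]
    simp

theorem mul_apply (P Q : PtnKernel σ) (a b : Ptn) :
    (P * Q) a b = formalSum fun c => P a c * Q c b := rfl

open Classical in
theorem one_apply (a b : Ptn) : (1 : PtnKernel σ) a b = if a = b then 1 else 0 := rfl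

noncomputable instance : MulAction (MvPowerSeries σ ℝ≥0∞) (PtnKernel σ) where
  smul c P := fun a b => c * P a b
  one_smul _ := ext fun _ _ => one_mul _
  mul_smul _ _ _ := ext fun _ _ => mul_assoc _ _ _

theorem smul_apply (c : MvPowerSeries σ ℝ≥0∞) (P : PtnKernel σ) (a b : Ptn) :
    (c • P) a b = c * P a b := rfl

instance : IsScalarTower (MvPowerSeries σ ℝ≥0∞) (PtnKernel σ) (PtnKernel σ) where
  smul_assoc c P Q := by
    ext1 a b
    simp only [smul_eq_mul, mul_apply, smul_apply, mul_formalSum, mul_assoc]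

instance : SMulCommClass (MvPowerSeries σ ℝ≥0∞) (PtnKernel σ) (PtnKernel σ) where
  smul_comm c P Q := by
    ext1 a b
    simp only [smul_eq_mul, mul_apply, smul_apply, mul_formalSum, mul_left_comm]

/-- The trace of an infinite matrix. -/
noncomputable def trace (P : PtnKernel σ) : MvPowerSeries σ ℝ≥0∞ := formalSum fun a => P a a

theorem trace_mul_comm (P Q : PtnKernel σ) : trace (P * Q) = trace (Q * P) := by
  simp only [trace, mul_apply]
  rw [formalSum_comm]
  simp only [mul_comm]

theorem trace_smul (c : MvPowerSeries σ ℝ≥0∞) (P : PtnKernel σ) :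
    trace (c • P) = c * trace P := by
  simp only [trace, smul_apply, mul_formalSum]

/-- The entries of a product of matrices as sums over paths. -/
theorem formalSum_path (h : ℕ) (K : Fin h → PtnKernel σ) (G : PtnKernel σ) :
    (formalSum fun L : Fin (h + 1) → Ptn =>
      G (L 0) (L (Fin.last h)) * ∏ i : Fin h, K i (L i.castSucc) (L i.succ)) =
    formalSum fun a => formalSum fun b => G a b * (List.ofFn K).prod a b := by
  classical
  induction h generalizing G with
  | zero =>
    rw [← formalSum_equiv (Equiv.funUnique (Fin 1) Ptn).symm]
    congr 1
    ext1 a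
    rw [formalSum_eq_single a _ fun b hb => by simp [one_apply, hb.symm]]
    simp [one_apply]
  | succ h ih =>
    rw [← formalSum_equiv (Fin.consEquiv fun _ : Fin (h + 1 + 1) => Ptn), formalSum_prod,
      formalSum_comm]
    have key := ih (fun i => K i.succ) fun b c => formalSum fun a => G a c * K 0 a b
    simp only [formalSum_mul] at key
    simp only [Fin.consEquiv_apply, Fin.prod_univ_succ, List.ofFn_succ, List.prod_cons, mul_apply,
      mul_formalSum]
    convert key using 1
    · congr 1
      ext1 L
      congr 1
      ext1 a
      rw [mul_assoc, ← Fin.succ_last]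
      simp
    · rw [formalSum_comm]
      conv_rhs => rw [formalSum_comm]
      congr 1
      ext1 b
      rw [formalSum_comm]
      simp only [mul_assoc]

/-- The diagonal matrix with entries `q ^ |λ|`. -/
noncomputable def diag (q : MvPowerSeries σ ℝ≥0∞) : PtnKernel σ :=
  fun a b => q ^ a.size * (1 : PtnKernel σ) a b

theorem diag_mul_apply (q : MvPowerSeries σ ℝ≥0∞) (P : PtnKernel σ) (a b : Ptn) :
    (diag q * P) a b = q ^ a.size * P a b := by
  rw [mul_apply, formalSum_eq_single a _ fun c hc => by simp [diag, one_apply, hc.symm]]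
  simp [diag, one_apply]

theorem mul_diag_apply (q : MvPowerSeries σ ℝ≥0∞) (P : PtnKernel σ) (a b : Ptn) :
    (P * diag q) a b = q ^ b.size * P a b := by
  rw [mul_apply, formalSum_eq_single b _ fun c hc => by simp [diag, one_apply, hc]]
  simp [diag, one_apply, mul_comm]

end PtnKernel

/-- The skew Schur function `s_{λ/μ}(x)` of a single variable. -/
noncomputable def skewSchurOne {R : Type*} [CommSemiring R] (x : R) (lam mu : Ptn) : R :=
  open Classical in if HStrip mu lam then x ^ (lam.size - mu.size) else 0

namespace PtnKernel

variable {σ : Type*}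

/-- The half-vertex operator adding a horizontal strip. -/
noncomputable def up (x : MvPowerSeries σ ℝ≥0∞) : PtnKernel σ := fun a b => skewSchurOne x b a

/-- The half-vertex operator removing a horizontal strip. -/
noncomputable def down (y : MvPowerSeries σ ℝ≥0∞) : PtnKernel σ := fun a b => skewSchurOne y a b

theorem up_mul_down (x y : MvPowerSeries σ ℝ≥0∞) :
    up x * down y = geomSum (x * y) • (down y * up x) := by
  ext1 a b
  rw [smul_apply, mul_apply, mul_apply,
    ← formalSum_subtype (fun c => HStrip a c ∧ HStrip b c) _ fun c hc => by
      simp only [up, down, skewSchurOne]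
      split_ifs <;> simp_all,
    ← formalSum_subtype (fun c => HStrip c a ∧ HStrip c b) _ fun c hc => by
      simp only [up, down, skewSchurOne]
      split_ifs <;> simp_all,
    geomSum, formalSum_mul]
  simp only [mul_formalSum]
  rw [← formalSum_prod (fun p : ℕ × {c // HStrip c a ∧ HStrip c b} =>
    (x * y) ^ p.1 * (down y a p.2.1 * up x p.2.1 b)), ← formalSum_equiv (HStrip.growthEquiv a b)]
  congr 1
  ext1 c
  have hs := HStrip.size_growthEquiv a b c
  obtain ⟨c, hac, hbc⟩ := c
  generalize HStrip.growthEquiv a b ⟨c, hac, hbc⟩ = p at hs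
  obtain ⟨k, d, hda, hdb⟩ := p
  have h1 := hac.size_le
  have h2 := hbc.size_le
  have h3 := hda.size_le
  have h4 := hdb.size_le
  simp only at hs
  simp only [up, down, skewSchurOne, if_pos hac, if_pos hbc, if_pos hda, if_pos hdb]
  rw [show c.size - a.size = k + (b.size - d.size) by omega,
    show c.size - b.size = k + (a.size - d.size) by omega]
  ring

theorem diag_mul_down (q y : MvPowerSeries σ ℝ≥0∞) :
    diag q * down y = down (q * y) * diag q := by
  ext1 a b
  rw [diag_mul_apply, mul_diag_apply]
  simp only [down, skewSchurOne]
  split_ifs with hab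
  · rw [mul_pow, ← mul_assoc, ← pow_add, Nat.add_sub_cancel' hab.size_le]
  · simp

theorem down_zero : down (0 : MvPowerSeries σ ℝ≥0∞) = 1 := by
  ext1 a b
  simp only [down, skewSchurOne, one_apply]
  by_cases h : a = b
  · subst h
    simp [HStrip.refl]
  · rw [if_neg h]
    split_ifs with hs
    · refine zero_pow fun h0 => h (hs.eq_of_size_eq ?_).symm
      have := hs.size_le
      omega
    · rfl

/-- The product of the operators `up x` for `x` in a list. -/
noncomputable def upList (X : List (MvPowerSeries σ ℝ≥0∞)) : PtnKernel σ := (X.map up).prod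

theorem upList_cons (x : MvPowerSeries σ ℝ≥0∞) (X : List (MvPowerSeries σ ℝ≥0∞)) :
    upList (x :: X) = up x * upList X := rfl

/-- The product of the operators `down y` for `y` in a list. -/
noncomputable def downList (Y : List (MvPowerSeries σ ℝ≥0∞)) : PtnKernel σ := (Y.map down).prod

/-- The product of the geometric series of `x * y` for `x` and `y` in two lists. -/
noncomputable def cauchyProd (X Y : List (MvPowerSeries σ ℝ≥0∞)) : MvPowerSeries σ ℝ≥0∞ :=
  (X.map fun x => (Y.map fun y => geomSum (x * y)).prod).prod

theorem cauchyProd_append_right (X Y Y' : List (MvPowerSeries σ ℝ≥0∞)) :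
    cauchyProd X (Y ++ Y') = cauchyProd X Y * cauchyProd X Y' := by
  simp [cauchyProd, List.prod_map_mul]

theorem up_mul_downList (x : MvPowerSeries σ ℝ≥0∞) (Y : List (MvPowerSeries σ ℝ≥0∞)) :
    up x * downList Y = (Y.map fun y => geomSum (x * y)).prod • (downList Y * up x) := by
  induction Y with
  | nil => simp [downList]
  | cons y Y ih =>
    simp only [downList, List.map_cons, List.prod_cons] at ih ⊢
    rw [← mul_assoc, up_mul_down, smul_mul_assoc, mul_assoc, ih, mul_smul_comm, smul_smul,
      mul_assoc]

theorem upList_mul_downList (X Y : List (MvPowerSeries σ ℝ≥0∞)) :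
    upList X * downList Y = cauchyProd X Y • (downList Y * upList X) := by
  induction X with
  | nil => simp [upList, cauchyProd]
  | cons x X ih =>
    simp only [upList, cauchyProd, List.map_cons, List.prod_cons] at ih ⊢
    rw [mul_assoc, ih, mul_smul_comm, ← mul_assoc, up_mul_downList, smul_mul_assoc, smul_smul,
      mul_assoc, mul_comm]

theorem diag_mul_downList (q : MvPowerSeries σ ℝ≥0∞) (Y : List (MvPowerSeries σ ℝ≥0∞)) :
    diag q * downList Y = downList (Y.map (q * ·)) * diag q := by
  induction Y with
  | nil => simp [downList]
  | cons y Y ih =>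
    simp only [downList, List.map_cons, List.prod_cons] at ih ⊢
    rw [← mul_assoc, diag_mul_down, mul_assoc, ih, mul_assoc]

theorem trace_diag_mul (q : MvPowerSeries σ ℝ≥0∞) (X Y : List (MvPowerSeries σ ℝ≥0∞)) :
    trace (diag q * (downList Y * upList X)) = cauchyProd X (Y.map (q * ·)) *
      trace (diag q * (downList (Y.map (q * ·)) * upList X)) := by
  rw [← mul_assoc, diag_mul_downList, mul_assoc, trace_mul_comm, mul_assoc, upList_mul_downList,
    mul_smul_comm, trace_smul]

theorem trace_diag_mul_iterate (q : MvPowerSeries σ ℝ≥0∞) (X Y : List (MvPowerSeries σ ℝ≥0∞))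
    (n : ℕ) :
    trace (diag q * (downList Y * upList X)) =
      (∏ k ∈ Finset.range n, cauchyProd X (Y.map (q ^ (k + 1) * ·))) *
        trace (diag q * (downList (Y.map (q ^ n * ·)) * upList X)) := by
  induction n with
  | zero => simp
  | succ n ih =>
    rw [ih, trace_diag_mul, Finset.prod_range_succ, List.map_map, mul_assoc]
    simp only [Function.comp_def, ← mul_assoc, ← pow_succ']

/-- Moving all the `down` operators of a product of operators to the left. -/
theorem prod_ofFn_eq (h : ℕ) (s : Fin h → Prop) [DecidablePred s]
    (X : Fin h → List (MvPowerSeries σ ℝ≥0∞)) :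
    (List.ofFn fun i => if s i then upList (X i) else downList (X i)).prod =
      (∏ i, ∏ j, if i < j ∧ s i ∧ ¬ s j then cauchyProd (X i) (X j) else 1) •
        (downList (List.ofFn fun i => if s i then [] else X i).flatten *
          upList (List.ofFn fun i => if s i then X i else []).flatten) := by
  induction h with
  | zero => simp [upList, downList]
  | succ h ih =>
    have happ : ∀ Z Z' : List (MvPowerSeries σ ℝ≥0∞), upList (Z ++ Z') = upList Z * upList Z' :=
      fun Z Z' => by simp [upList]
    have happ' : ∀ Z Z' : List (MvPowerSeries σ ℝ≥0∞),
        downList (Z ++ Z') = downList Z * downList Z' := fun Z Z' => by simp [downList]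
    have hcp : ∀ (k : ℕ) (x : List (MvPowerSeries σ ℝ≥0∞))
        (Z : Fin k → List (MvPowerSeries σ ℝ≥0∞)),
        cauchyProd x (List.ofFn Z).flatten = ∏ i, cauchyProd x (Z i) := by
      intro k x Z
      induction k with
      | zero => simp [cauchyProd]
      | succ k ihk =>
        rw [List.ofFn_succ, List.flatten_cons, cauchyProd_append_right, ihk, Fin.prod_univ_succ]
    have hnil : ∀ x : List (MvPowerSeries σ ℝ≥0∞), cauchyProd x [] = 1 := fun x => by
      simp [cauchyProd]
    rw [List.ofFn_succ, List.prod_cons, ih (fun i => s i.succ) fun i => X i.succ,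
      Fin.prod_univ_succ, List.ofFn_succ, List.ofFn_succ, List.flatten_cons, List.flatten_cons,
      happ, happ']
    simp only [Fin.prod_univ_succ (n := h), Fin.not_lt_zero, false_and, if_false, one_mul,
      Fin.succ_lt_succ_iff, Fin.succ_pos, true_and]
    by_cases h0 : s 0
    · simp only [h0, if_true, true_and]
      rw [mul_smul_comm, ← mul_assoc, upList_mul_downList, smul_mul_assoc, smul_smul, hcp, mul_comm]
      simp only [apply_ite (cauchyProd (X 0)), hnil, ite_not]
      simp [downList, mul_assoc]
    · simp only [h0, if_false, false_and]
      simp [upList, mul_assoc, mul_smul_comm]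

theorem upList_apply_of_not_le (X : List (MvPowerSeries σ ℝ≥0∞)) (a b : Ptn)
    (h : ¬ ∀ i, a.part i ≤ b.part i) : upList X a b = 0 := by
  induction X generalizing a with
  | nil =>
    rw [upList, List.map_nil, List.prod_nil, one_apply, if_neg]
    rintro rfl
    exact h fun _ => le_rfl
  | cons x X ih =>
    have : ∀ c, up x a c * upList X c b = 0 := fun c => by
      simp only [up, skewSchurOne]
      split_ifs with hac
      · rw [ih c fun hcb => h fun i => (hac i).1.trans (hcb i), mul_zero]
      · rw [zero_mul]
    rw [upList_cons, mul_apply, formalSum_eq_single a _ fun c _ => this c]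
    exact this a

theorem upList_apply_self (X : List (MvPowerSeries σ ℝ≥0∞)) (a : Ptn) : upList X a a = 1 := by
  induction X with
  | nil => simp [upList, one_apply]
  | cons x X ih =>
    rw [upList_cons, mul_apply, formalSum_eq_single a]
    · simp [ih, up, skewSchurOne, HStrip.refl]
    · intro c hc
      simp only [up, skewSchurOne]
      split_ifs with hac
      · rw [upList_apply_of_not_le, mul_zero]
        exact fun hca => hc (Ptn.ext_part fun i => (hca i).antisymm (hac i).1)
      · rw [zero_mul]

theorem trace_diag_mul_upList (q : MvPowerSeries σ ℝ≥0∞) (X : List (MvPowerSeries σ ℝ≥0∞)) :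
    trace (diag q * upList X) = formalSum fun a : Ptn => q ^ a.size := by
  simp [trace, diag_mul_apply, upList_apply_self]

end PtnKernel

end Kernel

section CongLE

variable {σ R : Type*} [CommSemiring R]

/-- Two power series agree in all exponents bounded by `m`. -/
def CongLE (m : σ →₀ ℕ) (a b : MvPowerSeries σ R) : Prop := ∀ n ≤ m, coeff n a = coeff n b

namespace CongLE

variable {m : σ →₀ ℕ} {a b c d : MvPowerSeries σ R}

theorem rfl : CongLE m a a := fun _ _ => Eq.refl _

theorem of_eq (h : a = b) : CongLE m a b := h ▸ CongLE.rfl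

theorem trans (h : CongLE m a b) (h' : CongLE m b c) : CongLE m a c :=
  fun n hn => (h n hn).trans (h' n hn)

theorem coeff_eq (h : CongLE m a b) : coeff m a = coeff m b := h m le_rfl

theorem mul (h : CongLE m a b) (h' : CongLE m c d) : CongLE m (a * c) (b * d) := by
  classical
  intro n hn
  rw [coeff_mul, coeff_mul]
  refine Finset.sum_congr _root_.rfl fun p hp => ?_
  have hp' := Finset.HasAntidiagonal.mem_antidiagonal.mp hp
  rw [h p.1 (le_trans (hp' ▸ le_self_add) hn), h' p.2 (le_trans (hp' ▸ le_add_self) hn)]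

theorem mul_zero_left (h : CongLE m a 0) (b : MvPowerSeries σ R) : CongLE m (a * b) 0 := by
  simpa using h.mul (CongLE.rfl (a := b))

theorem mul_zero_right (h : CongLE m a 0) (b : MvPowerSeries σ R) : CongLE m (b * a) 0 := by
  simpa using (CongLE.rfl (a := b)).mul h

theorem pow (h : CongLE m a b) (k : ℕ) : CongLE m (a ^ k) (b ^ k) := by
  induction k with
  | zero => simpa using CongLE.rfl
  | succ k ih => simpa only [pow_succ] using ih.mul h

theorem prod {ι : Type*} {s : Finset ι} {f g : ι → MvPowerSeries σ R}
    (h : ∀ i ∈ s, CongLE m (f i) (g i)) : CongLE m (∏ i ∈ s, f i) (∏ i ∈ s, g i) := by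
  classical
  induction s using Finset.induction_on with
  | empty => simpa using CongLE.rfl
  | insert i s hi ih =>
    rw [Finset.prod_insert hi, Finset.prod_insert hi]
    exact (h i (by simp)).mul (ih fun j hj => h j (by simp [hj]))

theorem formalSum {ι : Type*} {f g : ι → MvPowerSeries σ ℝ≥0∞}
    (h : ∀ i, CongLE m (f i) (g i)) : CongLE m (formalSum f) (formalSum g) := by
  intro n hn
  simpa using tsum_congr fun i => h i n hn

end CongLE

theorem congLE_X_pow_zero (m : σ →₀ ℕ) (i : σ) {k : ℕ} (hk : m i < k) :
    CongLE m ((MvPowerSeries.X i : MvPowerSeries σ R) ^ k) 0 := by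
  classical
  intro n hn
  rw [coeff_X_pow, if_neg, map_zero]
  rintro rfl
  have := hn i
  simp at this
  omega

/-- The geometric series `∑ t ^ k`, provided that `t` has constant coefficient zero. -/
noncomputable def geo (t : MvPowerSeries σ R) : MvPowerSeries σ R :=
  fun m => ∑ k ∈ Finset.range (m.degree + 1), coeff m (t ^ k)

theorem coeff_geo (t : MvPowerSeries σ R) (m : σ →₀ ℕ) :
    coeff m (geo t) = ∑ k ∈ Finset.range (m.degree + 1), coeff m (t ^ k) := rfl

theorem map_geo {S : Type*} [CommSemiring S] (f : R →+* S) (t : MvPowerSeries σ R) :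
    MvPowerSeries.map f (geo t) = geo (MvPowerSeries.map f t) := by
  ext m
  simp only [coeff_map, coeff_geo, map_sum, ← map_pow]

theorem congLE_geo_one {t : MvPowerSeries σ R} {m : σ →₀ ℕ} (h : CongLE m t 0) :
    CongLE m (geo t) 1 := by
  intro n hn
  rw [coeff_geo, Finset.sum_eq_single_of_mem 0 (by simp)]
  · simp
  · intro k _ hk
    rw [h.pow k n hn, zero_pow hk, map_zero]

theorem geo_zero : geo (0 : MvPowerSeries σ R) = 1 := by
  ext m
  exact (congLE_geo_one (m := m) CongLE.rfl).coeff_eq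

theorem coeff_pow_eq_zero {t : MvPowerSeries σ R} (ht : constantCoeff t = 0) {m : σ →₀ ℕ} {k : ℕ}
    (hk : m.degree < k) : coeff m (t ^ k) = 0 := by
  refine coeff_of_lt_order (lt_of_lt_of_le ?_ (le_order_pow_of_constantCoeff_eq_zero k ht))
  exact_mod_cast hk

theorem coeff_geo_of_le {t : MvPowerSeries σ R} (ht : constantCoeff t = 0) {m : σ →₀ ℕ} {d : ℕ}
    (hd : m.degree ≤ d) : coeff m (geo t) = coeff m (∑ k ∈ Finset.range (d + 1), t ^ k) := by
  rw [coeff_geo, map_sum]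
  refine Finset.sum_subset (by simpa using hd) fun k _ hk => coeff_pow_eq_zero ht ?_
  simp at hk
  omega

theorem geomSum_eq_geo {t : MvPowerSeries σ ℝ≥0∞} (ht : constantCoeff t = 0) :
    geomSum t = geo t := by
  ext m
  rw [coeff_geo]
  refine tsum_eq_sum fun k hk => coeff_pow_eq_zero ht ?_
  simp at hk
  omega

theorem inv_one_sub_eq_geo {F : Type*} [Field F] {t : MvPowerSeries σ F}
    (ht : constantCoeff t = 0) : (1 - t)⁻¹ = geo t := by
  symm
  rw [MvPowerSeries.eq_inv_iff_mul_eq_one (by simp [ht])]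
  ext m
  have h : CongLE m (geo t) (∑ k ∈ Finset.range (m.degree + 1), t ^ k) :=
    fun n hn => coeff_geo_of_le ht (Finsupp.degree_mono hn)
  rw [(h.mul CongLE.rfl).coeff_eq, geom_sum_mul_neg, map_sub, coeff_pow_eq_zero ht (by omega),
    sub_zero]

end CongLE

section Topology

variable {σ ι : Type*}

instance : T2Space (MvPowerSeries σ ℚ) := inferInstanceAs (T2Space ((σ →₀ ℕ) → ℚ))

theorem hasSum_iff_coeff {f : ι → MvPowerSeries σ ℚ} {a : MvPowerSeries σ ℚ} :
    HasSum f a ↔ ∀ m, HasSum (fun i => coeff m (f i)) (coeff m a) :=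
  Pi.hasSum (X := fun _ : σ →₀ ℕ => ℚ)

theorem hasProd_of_congLE {f : ι → MvPowerSeries σ ℚ} {s : (σ →₀ ℕ) → Finset ι}
    (hs : ∀ m, ∀ i ∉ s m, CongLE m (f i) 1) :
    HasProd f (fun m => coeff m (∏ i ∈ s m, f i) : MvPowerSeries σ ℚ) := by
  refine tendsto_pi_nhds (A := fun _ : σ →₀ ℕ => ℚ) |>.mpr fun m => ?_
  refine tendsto_const_nhds.congr' ?_
  rw [SummationFilter.unconditional_filter]
  filter_upwards [Filter.eventually_ge_atTop (s m)] with t ht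
  classical
  rw [← Finset.prod_sdiff ht]
  have h : CongLE m ((∏ i ∈ t \ s m, f i) * ∏ i ∈ s m, f i) (1 * ∏ i ∈ s m, f i) := by
    refine CongLE.mul ?_ CongLE.rfl
    rw [← Finset.prod_const_one (s := t \ s m)]
    exact CongLE.prod fun i hi => hs m i (Finset.mem_sdiff.mp hi).2
  rw [one_mul] at h
  exact h.coeff_eq.symm

/-- An infinite product may be truncated when only a bounded set of exponents matters. -/
theorem congLE_tprod {f : ι → MvPowerSeries σ ℚ}
    (hf : ∀ m, ∃ s : Finset ι, ∀ i ∉ s, CongLE m (f i) 1) {m : σ →₀ ℕ} (s : Finset ι)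
    (hs : ∀ i ∉ s, CongLE m (f i) 1) : CongLE m (∏' i, f i) (∏ i ∈ s, f i) := by
  classical
  intro n hn
  choose S hS using hf
  rw [(hasProd_of_congLE (s := Function.update S n s) fun k i hi => ?_).tprod_eq]
  · change coeff n (∏ i ∈ Function.update S n s n, f i) = _
    simp
  · by_cases hk : k = n
    · subst hk
      simp only [Function.update_self] at hi
      exact fun l hl => hs i hi l (hl.trans hn)
    · rw [Function.update_of_ne hk] at hi
      exact hS k i hi

/-- The variables tend to zero: modulo any exponent bound, almost all of them vanish. -/
def VanishesAtTop (X : ℕ → MvPowerSeries σ ℚ) : Prop :=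
  ∀ m, ∃ N, ∀ n, N ≤ n → CongLE m (X n) 0

theorem congLE_Psi {X Y : ℕ → MvPowerSeries σ ℚ} (hX : VanishesAtTop X) (hY : VanishesAtTop Y)
    (hX0 : ∀ n, constantCoeff (X n) = 0) {m : σ →₀ ℕ} {M N : ℕ}
    (hM : ∀ n, M ≤ n → CongLE m (X n) 0) (hN : ∀ n, N ≤ n → CongLE m (Y n) 0) :
    CongLE m (Psi X Y)
      (∏ p ∈ Finset.range M, ∏ q ∈ Finset.range N, geo (X p * Y q)) := by
  have hgeo : ∀ p : ℕ × ℕ, (1 - X p.1 * Y p.2)⁻¹ = geo (X p.1 * Y p.2) :=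
    fun p => inv_one_sub_eq_geo (by simp [hX0])
  have key : ∀ {m : σ →₀ ℕ} {M N : ℕ} (_ : ∀ n, M ≤ n → CongLE m (X n) 0)
      (_ : ∀ n, N ≤ n → CongLE m (Y n) 0),
      ∀ p ∉ Finset.range M ×ˢ Finset.range N, CongLE m (geo (X p.1 * Y p.2)) 1 := by
    intro m M N hM hN p hp
    refine congLE_geo_one ?_
    by_cases h : p.1 < M
    · exact (hN p.2 (by simpa [h] using hp)).mul_zero_right _
    · exact (hM p.1 (not_lt.mp h)).mul_zero_left _
  rw [Psi, ← Finset.prod_product' _ _ fun p q => geo (X p * Y q)]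
  simp only [hgeo]
  refine congLE_tprod (fun m => ?_) _ (key hM hN)
  obtain ⟨M, hM⟩ := hX m
  obtain ⟨N, hN⟩ := hY m
  exact ⟨_, key hM hN⟩

theorem hasSum_natCast_of_ennreal {a : ι → ℕ} {p : ℕ} (h : ∑' i, (a i : ℝ≥0∞) = p) :
    HasSum (fun i => (a i : ℚ)) p := by
  have hfin : {i | 1 ≤ (a i : ℝ≥0∞)}.Finite :=
    ENNReal.finite_const_le_of_tsum_ne_top (h ▸ ENNReal.natCast_ne_top p) one_ne_zero
  have hzero : ∀ i ∉ hfin.toFinset, a i = 0 := fun i hi => by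
    by_contra h0
    exact hi (by simpa using Nat.one_le_iff_ne_zero.mpr h0)
  rw [tsum_eq_sum (s := hfin.toFinset) fun i hi => by simp [hzero i hi]] at h
  have h' : ∑ i ∈ hfin.toFinset, a i = p := by exact_mod_cast h
  rw [← h', Nat.cast_sum]
  exact hasSum_sum_of_ne_finset_zero fun i hi => by simp [hzero i hi]

end Topology

section PartitionSum

/-- Removing the full columns of a partition with at most `n + 1` parts. -/
noncomputable def Ptn.removeColumnsEquiv (n : ℕ) :
    {a : Ptn // a.part (n + 1) = 0} ≃ ℕ × {a : Ptn // a.part n = 0} where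
  toFun a := (a.1.part n, ⟨ofAntitone (fun i => a.1.part i - a.1.part n)
    (antitone_nat_of_succ_le fun i => Nat.sub_le_sub_right (a.1.part_antitone (Nat.le_succ i)) _)
      n (Nat.sub_self _),
      Nat.sub_self _⟩)
  invFun p := ⟨ofAntitone (fun i => if i ≤ n then p.2.1.part i + p.1 else 0)
    (antitone_nat_of_succ_le fun i => by
      have := p.2.1.part_antitone (Nat.le_succ i)
      simp only [Nat.succ_eq_add_one] at this
      split_ifs <;> omega) (n + 1) (by simp), by simp⟩
  left_inv a := by
    refine Subtype.ext (ext_part fun i => ?_)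
    simp only [part_ofAntitone]
    split_ifs with hi
    · exact Nat.sub_add_cancel (a.1.part_antitone hi)
    · have h1 := a.1.part_antitone (by omega : n + 1 ≤ i)
      have h2 := a.2
      omega
  right_inv p := by
    have h := p.2.2
    refine Prod.ext (by simpa using h) (Subtype.ext (ext_part fun i => ?_))
    simp only [part_ofAntitone, le_refl, if_true, h, zero_add]
    split_ifs with hi
    · simp
    · have h1 := p.2.1.part_antitone (by omega : n ≤ i)
      omega

theorem Ptn.size_removeColumnsEquiv (n : ℕ) (a : {a : Ptn // a.part (n + 1) = 0}) :
    a.1.size = (n + 1) * (removeColumnsEquiv n a).1 + (removeColumnsEquiv n a).2.1.size := by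
  rw [a.1.size_eq_sum_range a.2, size_eq_sum_range _ (removeColumnsEquiv n a).2.2]
  simp only [removeColumnsEquiv, Equiv.coe_fn_mk, part_ofAntitone]
  rw [Finset.sum_range_succ, add_mul, one_mul]
  have h : ∑ i ∈ Finset.range n, a.1.part i =
      ∑ i ∈ Finset.range n, (a.1.part n + (a.1.part i - a.1.part n)) :=
    Finset.sum_congr rfl fun i hi =>
      (Nat.add_sub_cancel' (a.1.part_antitone (by simpa using (Finset.mem_range.mp hi).le))).symm
  rw [h, Finset.sum_add_distrib, Finset.sum_const, Finset.card_range, smul_eq_mul]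
  ring

variable {σ : Type*}

theorem formalSum_size_subtype (q : MvPowerSeries σ ℝ≥0∞) (n : ℕ) :
    (formalSum fun a : {a : Ptn // a.part n = 0} => q ^ a.1.size) =
      ∏ k ∈ Finset.range n, geomSum (q ^ (k + 1)) := by
  induction n with
  | zero =>
    have h0 : ∀ a : {a : Ptn // a.part 0 = 0},
        a = ⟨Ptn.ofAntitone (fun _ => 0) (fun _ _ _ => le_rfl) 0 rfl, rfl⟩ := fun a =>
      Subtype.ext (Ptn.ext_part fun i => Nat.le_zero.mp
        ((a.1.part_antitone (Nat.zero_le i)).trans_eq a.2))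
    rw [formalSum_eq_single _ _ fun a ha => absurd (h0 a) ha,
      Ptn.size_eq_sum_range (n := 0) _ rfl]
    simp
  | succ n ih =>
    rw [Finset.prod_range_succ, ← ih, mul_comm, geomSum, formalSum_mul]
    simp only [mul_formalSum]
    rw [← formalSum_prod (fun p : ℕ × {a : Ptn // a.part n = 0} =>
      (q ^ (n + 1)) ^ p.1 * q ^ p.2.1.size), ← formalSum_equiv (Ptn.removeColumnsEquiv n)]
    congr 1
    ext1 a
    rw [← pow_mul, ← pow_add, ← Ptn.size_removeColumnsEquiv]

/-- The generating function of partitions, truncated. -/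
theorem congLE_formalSum_size {q : MvPowerSeries σ ℝ≥0∞} {m : σ →₀ ℕ} {n : ℕ}
    (hq : CongLE m (q ^ n) 0) :
    CongLE m (formalSum fun a : Ptn => q ^ a.size)
      (∏ k ∈ Finset.range n, geomSum (q ^ (k + 1))) := by
  classical
  have h := formalSum_subtype (fun a : Ptn => a.part n = 0)
    (fun a : Ptn => if a.part n = 0 then q ^ a.size else 0) fun a ha => if_neg ha
  rw [← formalSum_size_subtype,
    show (fun a : {a : Ptn // a.part n = 0} => q ^ a.1.size) =
      fun a => if a.1.part n = 0 then q ^ a.1.size else 0 from funext fun a => (if_pos a.2).symm, h]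
  refine CongLE.formalSum fun a => ?_
  split_ifs with ha
  · exact CongLE.rfl
  · obtain ⟨N, hN⟩ := a.exists_part_eq_zero
    have hnN : n ≤ N := by
      by_contra hlt
      exact ha (Nat.le_zero.mp (hN ▸ a.part_antitone (by omega : N ≤ n)))
    have hle : n ≤ a.size := by
      rw [a.size_eq_sum_range hN]
      calc n = ∑ _i ∈ Finset.range n, 1 := by simp
        _ ≤ ∑ i ∈ Finset.range n, a.part i := Finset.sum_le_sum fun i hi =>
          (Nat.one_le_iff_ne_zero.mpr ha).trans (a.part_antitone (Finset.mem_range.mp hi).le)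
        _ ≤ _ := Finset.sum_le_sum_of_subset (by simpa using hnN)
    rw [← Nat.add_sub_cancel' hle, pow_add]
    exact hq.mul_zero_left _

end PartitionSum

namespace PtnKernel

variable {σ : Type*}

theorem cauchyProd_ofFn_flatten {M N : ℕ} (X : Fin M → List (MvPowerSeries σ ℝ≥0∞))
    (Y : Fin N → List (MvPowerSeries σ ℝ≥0∞)) :
    cauchyProd (List.ofFn X).flatten (List.ofFn Y).flatten = ∏ i, ∏ j, cauchyProd (X i) (Y j) := by
  simp only [cauchyProd]
  rw [List.map_flatten, List.prod_flatten, List.map_ofFn, List.map_ofFn, List.prod_ofFn]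
  refine Finset.prod_congr rfl fun i _ => ?_
  simp only [Function.comp_apply, List.map_flatten, List.prod_flatten, List.map_ofFn,
    List.prod_ofFn]
  induction X i with
  | nil => simp
  | cons x l ih => simp [ih, Finset.prod_mul_distrib]

theorem congLE_mul {P P' Q Q' : PtnKernel σ} {m : σ →₀ ℕ}
    (h : ∀ a b, CongLE m (P a b) (P' a b)) (h' : ∀ a b, CongLE m (Q a b) (Q' a b)) (a b : Ptn) :
    CongLE m ((P * Q) a b) ((P' * Q') a b) :=
  CongLE.formalSum fun c => (h a c).mul (h' c b)

theorem congLE_downList {Y : List (MvPowerSeries σ ℝ≥0∞)} {m : σ →₀ ℕ}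
    (hY : ∀ y ∈ Y, CongLE m y 0) (a b : Ptn) :
    CongLE m (downList Y a b) ((1 : PtnKernel σ) a b) := by
  induction Y generalizing a b with
  | nil => exact CongLE.rfl
  | cons y Y ih =>
    rw [← one_mul (1 : PtnKernel σ)]
    refine congLE_mul (P := down y) (Q := downList Y) (fun c d => ?_)
      (fun c d => ih (fun y hy => hY y (by simp [hy])) c d) a b
    rw [← down_zero]
    simp only [down, skewSchurOne]
    split_ifs
    · exact (hY y (by simp)).pow _
    · exact CongLE.rfl

/-- The trace formula modulo a power of `q`. -/
theorem congLE_trace {q : MvPowerSeries σ ℝ≥0∞} {m : σ →₀ ℕ} {n : ℕ}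
    (hq : CongLE m (q ^ n) 0) (X Y : List (MvPowerSeries σ ℝ≥0∞)) :
    CongLE m (trace (diag q * (downList Y * upList X)))
      (∏ k ∈ Finset.range n, (cauchyProd X (Y.map (q ^ (k + 1) * ·)) * geomSum (q ^ (k + 1)))) := by
  rw [trace_diag_mul_iterate q X Y n, Finset.prod_mul_distrib]
  refine CongLE.rfl.mul (CongLE.trans ?_ (congLE_formalSum_size hq))
  rw [← trace_diag_mul_upList q X]
  refine CongLE.formalSum fun a => congLE_mul (fun _ _ => CongLE.rfl) (fun b c => ?_) a a
  conv_rhs => rw [← one_mul (upList X)]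
  refine congLE_mul (fun b c => congLE_downList (fun y hy => ?_) b c) (fun _ _ => CongLE.rfl) b c
  obtain ⟨y, _, rfl⟩ := List.mem_map.mp hy
  exact hq.mul_zero_left _

end PtnKernel

section SkewSchur

/-- The skew Schur polynomial `s_{λ/μ}` in the first `N` variables of an alphabet. -/
noncomputable def finSkewSchur {R : Type*} [CommSemiring R] (X : ℕ → R) : ℕ → Ptn → Ptn → R
  | 0, lam, mu => open Classical in if lam = mu then 1 else 0
  | N + 1, lam, mu => ∑ nu ∈ (HStrip.finite_left lam).toFinset,
      finSkewSchur X N nu mu * skewSchurOne (X N) lam nu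

theorem map_finSkewSchur {R S : Type*} [CommSemiring R] [CommSemiring S] (f : R →+* S)
    (X : ℕ → R) (N : ℕ) (lam mu : Ptn) :
    f (finSkewSchur X N lam mu) = finSkewSchur (fun n => f (X n)) N lam mu := by
  induction N generalizing lam with
  | zero => simp only [finSkewSchur]; split_ifs <;> simp
  | succ N ih =>
    simp only [finSkewSchur, map_sum, map_mul, ih]
    refine Finset.sum_congr rfl fun nu _ => ?_
    congr 1
    simp only [skewSchurOne]
    split_ifs <;> simp

namespace PtnKernel

variable {σ : Type*}

theorem formalSum_mul_skewSchurOne (f : Ptn → MvPowerSeries σ ℝ≥0∞) (x : MvPowerSeries σ ℝ≥0∞)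
    (lam : Ptn) : (formalSum fun nu => f nu * skewSchurOne x lam nu) =
      ∑ nu ∈ (HStrip.finite_left lam).toFinset, f nu * skewSchurOne x lam nu :=
  formalSum_eq_sum _ _ fun nu hnu => by
    rw [skewSchurOne, if_neg (by simpa using hnu), mul_zero]

theorem upList_range_apply (X : ℕ → MvPowerSeries σ ℝ≥0∞) (N : ℕ) (lam mu : Ptn) :
    upList ((List.range N).map X) mu lam = finSkewSchur X N lam mu := by
  induction N generalizing lam with
  | zero =>
    rw [finSkewSchur, List.range_zero, List.map_nil, upList, List.map_nil, List.prod_nil, one_apply]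
    split_ifs <;> simp_all
  | succ N ih =>
    have h : upList ((List.range (N + 1)).map X) = upList ((List.range N).map X) * up (X N) := by
      simp [upList, List.range_succ]
    rw [h, mul_apply, finSkewSchur, ← formalSum_mul_skewSchurOne]
    simp only [ih, up]

theorem downList_range_apply (X : ℕ → MvPowerSeries σ ℝ≥0∞) (N : ℕ) (lam mu : Ptn) :
    downList ((List.range N).map X).reverse lam mu = finSkewSchur X N lam mu := by
  induction N generalizing lam with
  | zero => simp [downList, finSkewSchur, one_apply]
  | succ N ih =>
    have h : downList ((List.range (N + 1)).map X).reverse =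
        down (X N) * downList ((List.range N).map X).reverse := by
      simp [downList, List.range_succ]
    rw [h, mul_apply, finSkewSchur, ← formalSum_mul_skewSchurOne]
    simp only [ih, down, mul_comm]

end PtnKernel

open Classical in
/-- The chains from `mu` to `lam` that are constant from step `N` on. -/
noncomputable def chainFinset : ℕ → Ptn → Ptn → Finset (ℕ → Ptn)
  | 0, lam, mu => if lam = mu then {fun _ => lam} else ∅
  | N + 1, lam, mu => ((HStrip.finite_left lam).toFinset.sigma fun nu => chainFinset N nu mu).image
      fun p i => if i ≤ N then p.2 i else lam

theorem mem_chainFinset {N : ℕ} {lam mu : Ptn} {c : ℕ → Ptn} :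
    c ∈ chainFinset N lam mu ↔
      c 0 = mu ∧ (∀ i, HStrip (c i) (c (i + 1))) ∧ ∀ i, N ≤ i → c i = lam := by
  induction N generalizing lam c with
  | zero =>
    simp only [chainFinset]
    constructor
    · split_ifs with h
      · subst h
        intro hc
        rw [Finset.mem_singleton] at hc
        subst hc
        exact ⟨rfl, fun _ => HStrip.refl _, fun _ _ => rfl⟩
      · simp
    · rintro ⟨h0, -, h2⟩
      rw [if_pos ((h2 0 le_rfl).symm.trans h0), Finset.mem_singleton]
      exact funext fun i => h2 i (Nat.zero_le i)
  | succ N ih =>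
    simp only [chainFinset, Finset.mem_image, Finset.mem_sigma, ih, Set.Finite.mem_toFinset,
      Set.mem_ofPred_eq, Sigma.exists]
    constructor
    · rintro ⟨nu, d, ⟨hnu, h0, h1, h2⟩, rfl⟩
      refine ⟨by simpa using h0, fun i => ?_, fun i hi => if_neg (by omega)⟩
      rcases lt_trichotomy i N with hi | rfl | hi
      · simpa [hi.le, Nat.succ_le_of_lt hi] using h1 i
      · simpa [h2 i le_rfl] using hnu
      · simpa [show ¬ i ≤ N by omega, show ¬ i + 1 ≤ N by omega] using HStrip.refl lam
    · rintro ⟨h0, h1, h2⟩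
      refine ⟨c N, fun i => c (min i N), ⟨?_, by simpa using h0, fun i => ?_, fun i hi => ?_⟩, ?_⟩
      · simpa [h2 (N + 1) le_rfl] using h1 N
      · rcases lt_or_ge i N with hi | hi
        · simpa [hi.le, Nat.succ_le_of_lt hi] using h1 i
        · simpa [hi, hi.trans (Nat.le_succ i)] using HStrip.refl (c N)
      · simp [hi]
      · ext1 i
        split_ifs with hi
        · simp [hi]
        · exact (h2 i (by omega)).symm

theorem sum_chainFinset {R : Type*} [CommSemiring R] (X : ℕ → R) (N : ℕ) (lam mu : Ptn) :
    ∑ c ∈ chainFinset N lam mu, ∏ i ∈ Finset.range N, X i ^ ((c (i + 1)).size - (c i).size) =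
      finSkewSchur X N lam mu := by
  classical
  induction N generalizing lam with
  | zero => simp only [chainFinset, finSkewSchur]; split_ifs <;> simp
  | succ N ih =>
    rw [chainFinset, Finset.sum_image, Finset.sum_sigma, finSkewSchur]
    · refine Finset.sum_congr rfl fun nu hnu => ?_
      rw [← ih, Finset.sum_mul]
      refine Finset.sum_congr rfl fun c hc => ?_
      have hc' := (mem_chainFinset.mp hc).2.2 N le_rfl
      rw [Finset.prod_range_succ]
      congr 1
      · refine Finset.prod_congr rfl fun i hi => ?_
        have hi' := Finset.mem_range.mp hi
        simp [hi'.le, Nat.succ_le_of_lt hi']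
      · rw [skewSchurOne, if_pos (by simpa using hnu)]
        simp [hc']
    · rintro ⟨nu, c⟩ hc ⟨nu', c'⟩ hc' h
      simp only [Finset.coe_sigma, Set.mem_sigma_iff, Finset.mem_coe] at hc hc'
      have h2 := (mem_chainFinset.mp hc.2).2.2
      have h2' := (mem_chainFinset.mp hc'.2).2.2
      have hcc : ∀ i ≤ N, c i = c' i := fun i hi => by simpa [hi] using congr_fun h i
      have hnu : nu = nu' := by rw [← h2 N le_rfl, hcc N le_rfl, h2' N le_rfl]
      subst hnu
      have : c = c' := funext fun i => by
        rcases le_total i N with hi | hi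
        · exact hcc i hi
        · rw [h2 i hi, h2' i hi]
      rw [this]

theorem chainWeight_eq_prod_range {R : Type*} [CommRing R] (X : ℕ → R) {c : ℕ → Ptn} {lam : Ptn}
    {N : ℕ} (h : ∀ i, N ≤ i → c i = lam) :
    chainWeight X c = ∏ i ∈ Finset.range N, X i ^ ((c (i + 1)).size - (c i).size) := by
  refine finprod_eq_prod_of_mulSupport_subset _ fun i hi => ?_
  by_contra hiN
  have hN : N ≤ i := by simpa using hiN
  exact hi (by simp [h i hN, h (i + 1) (by omega)])

variable {σ : Type*}

theorem congLE_chainWeight_zero {X : ℕ → MvPowerSeries σ ℚ} {m : σ →₀ ℕ} {N : ℕ}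
    (hN : ∀ n, N ≤ n → CongLE m (X n) 0) {lam mu : Ptn} {c : ℕ → Ptn} (hc : IsSchurChain mu lam c)
    (hcN : c ∉ chainFinset N lam mu) : CongLE m (chainWeight X c) 0 := by
  obtain ⟨h0, h1, M, hM⟩ := hc
  have hex : ∃ j, N ≤ j ∧ c j ≠ c (j + 1) := by
    by_contra! hcon
    refine hcN (mem_chainFinset.mpr ⟨h0, h1, fun i hi => ?_⟩)
    have hconst : ∀ k, c (i + k) = c i := fun k => by
      induction k with
      | zero => rfl
      | succ k ih => rw [← add_assoc, ← hcon (i + k) (by omega), ih]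
    rw [← hconst M, hM _ (by omega)]
  obtain ⟨j, hj, hne⟩ := hex
  have hjM : j ∈ Finset.range M := by
    by_contra hjM
    have hMj : M ≤ j := by simpa using hjM
    exact hne ((hM j hMj).trans (hM (j + 1) (by omega)).symm)
  rw [chainWeight_eq_prod_range X hM, ← Finset.mul_prod_erase _ _ hjM]
  refine CongLE.mul_zero_left ?_ _
  have hpos : (c (j + 1)).size - (c j).size ≠ 0 := fun h => by
    have := (h1 j).size_le
    exact hne ((h1 j).eq_of_size_eq (by omega))
  simpa [zero_pow hpos] using (hN j hj).pow ((c (j + 1)).size - (c j).size)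

/-- A skew Schur function may be truncated to finitely many variables when only a bounded set of
exponents matters. -/
theorem congLE_skewSchur {X : ℕ → MvPowerSeries σ ℚ} (hX : VanishesAtTop X) {m : σ →₀ ℕ} {N : ℕ}
    (hN : ∀ n, N ≤ n → CongLE m (X n) 0) (lam mu : Ptn) :
    CongLE m (skewSchur X lam mu) (finSkewSchur X N lam mu) := by
  classical
  have key : ∀ {m : σ →₀ ℕ} {N : ℕ} (_ : ∀ n, N ≤ n → CongLE m (X n) 0) (n : σ →₀ ℕ) (_ : n ≤ m),
      HasSum (fun c : {c : ℕ → Ptn // IsSchurChain mu lam c} => coeff n (chainWeight X c.1))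
        (coeff n (finSkewSchur X N lam mu)) := by
    intro m N hN n hn
    have hsub : ∀ c ∈ chainFinset N lam mu, IsSchurChain mu lam c := fun c hc =>
      ⟨(mem_chainFinset.mp hc).1, (mem_chainFinset.mp hc).2.1, N, (mem_chainFinset.mp hc).2.2⟩
    rw [← sum_chainFinset, map_sum, ← Finset.sum_subtype_of_mem _ hsub]
    have hweight : ∀ c ∈ (chainFinset N lam mu).subtype (IsSchurChain mu lam),
        coeff n (∏ i ∈ Finset.range N, X i ^ ((c.1 (i + 1)).size - (c.1 i).size)) =
          coeff n (chainWeight X c.1) := fun c hc => by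
      rw [chainWeight_eq_prod_range X (mem_chainFinset.mp (Finset.mem_subtype.mp hc)).2.2]
    rw [Finset.sum_congr rfl hweight]
    refine hasSum_sum_of_ne_finset_zero fun c hc => ?_
    exact congLE_chainWeight_zero hN c.2 (fun h => hc (Finset.mem_subtype.mpr h)) n hn
  choose M hM using hX
  have hsum : HasSum (fun c : {c : ℕ → Ptn // IsSchurChain mu lam c} => chainWeight X c.1)
      (fun n => coeff n (finSkewSchur X (M n) lam mu) : MvPowerSeries σ ℚ) :=
    hasSum_iff_coeff.mpr fun n => key (hM n) n le_rfl
  intro n hn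
  rw [skewSchur]
  exact (hasSum_iff_coeff.mp hsum.summable.hasSum n).unique (key hN n hn)

end SkewSchur

section Cylindric

variable {σ : Type*} {h : ℕ}

/-- A summand of the cylindric sum, in the first `N` variables of each alphabet. -/
noncomputable def cylindricTerm {R : Type*} [CommSemiring R] (s : Fin h → Prop) [DecidablePred s]
    (q : R) (x : Fin h → ℕ → R) (N : ℕ) (L : Fin (h + 1) → Ptn) : R :=
  q ^ (L (Fin.last h)).size * ∏ i : Fin h,
    if s i then finSkewSchur (x i) N (L i.succ) (L i.castSucc)
    else finSkewSchur (x i) N (L i.castSucc) (L i.succ)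

/-- The product side of the cylindric summation formula, in the first `N` variables of each
alphabet and with `K` winding factors. -/
noncomputable def cylindricProd {R : Type*} [CommSemiring R] (s : Fin h → Prop) [DecidablePred s]
    (q : MvPowerSeries σ R) (x : Fin h → ℕ → MvPowerSeries σ R) (N K : ℕ) : MvPowerSeries σ R :=
  (∏ i, ∏ j, if i < j ∧ s i ∧ ¬ s j then
      ∏ a ∈ Finset.range N, ∏ b ∈ Finset.range N, geo (x i a * x j b) else 1) *
    ∏ k ∈ Finset.range K, ((∏ i, ∏ j, if s i ∧ ¬ s j then
      ∏ a ∈ Finset.range N, ∏ b ∈ Finset.range N, geo (x i a * (q ^ (k + 1) * x j b)) else 1) *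
        geo (q ^ (k + 1)))

theorem map_cylindricTerm {R S : Type*} [CommSemiring R] [CommSemiring S] (f : R →+* S)
    (s : Fin h → Prop) [DecidablePred s] (q : R) (x : Fin h → ℕ → R) (N : ℕ)
    (L : Fin (h + 1) → Ptn) :
    f (cylindricTerm s q x N L) = cylindricTerm s (f q) (fun i n => f (x i n)) N L := by
  simp only [cylindricTerm, map_mul, map_pow, map_prod, apply_ite f, map_finSkewSchur]

theorem map_cylindricProd {R S : Type*} [CommSemiring R] [CommSemiring S] (f : R →+* S)
    (s : Fin h → Prop) [DecidablePred s] (q : MvPowerSeries σ R)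
    (x : Fin h → ℕ → MvPowerSeries σ R) (N K : ℕ) :
    MvPowerSeries.map f (cylindricProd s q x N K) =
      cylindricProd s (MvPowerSeries.map f q) (fun i n => MvPowerSeries.map f (x i n)) N K := by
  simp only [cylindricProd, map_mul, map_pow, map_prod, apply_ite (MvPowerSeries.map f), map_geo,
    map_one]

namespace PtnKernel

theorem cauchyProd_reverse_right (X Y : List (MvPowerSeries σ ℝ≥0∞)) :
    cauchyProd X Y.reverse = cauchyProd X Y := by
  simp only [cauchyProd, List.map_reverse, (List.reverse_perm _).prod_eq]

theorem cauchyProd_map_range {x y : ℕ → MvPowerSeries σ ℝ≥0∞}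
    (hx : ∀ n, constantCoeff (x n) = 0) (N : ℕ) :
    cauchyProd ((List.range N).map x) ((List.range N).map y) =
      ∏ a ∈ Finset.range N, ∏ b ∈ Finset.range N, geo (x a * y b) := by
  have hlist : ∀ f : ℕ → MvPowerSeries σ ℝ≥0∞,
      ((List.range N).map f).prod = ∏ a ∈ Finset.range N, f a := fun f => rfl
  have hgeo : ∀ a b, geomSum (x a * y b) = geo (x a * y b) := fun a b =>
    geomSum_eq_geo (by simp [hx])
  simp only [cauchyProd, List.map_map, Function.comp_def, hlist, hgeo]

theorem congLE_formalSum_cylindricTerm (s : Fin h → Prop) [DecidablePred s]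
    {q : MvPowerSeries σ ℝ≥0∞} {x : Fin h → ℕ → MvPowerSeries σ ℝ≥0∞}
    (hq0 : constantCoeff q = 0) (hx0 : ∀ i n, constantCoeff (x i n) = 0) {m : σ →₀ ℕ} {K : ℕ}
    (hq : CongLE m (q ^ K) 0) (N : ℕ) :
    CongLE m (formalSum fun L : {L : Fin (h + 1) → Ptn // L 0 = L (Fin.last h)} =>
      cylindricTerm s q x N L.1) (cylindricProd s q x N K) := by
  set X : Fin h → List (MvPowerSeries σ ℝ≥0∞) := fun i =>
    if s i then (List.range N).map (x i) else ((List.range N).map (x i)).reverse with hX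
  set Q : Fin h → PtnKernel σ := fun i => if s i then upList (X i) else downList (X i) with hQ
  have hQ_apply : ∀ i a b, Q i a b = if s i then finSkewSchur (x i) N b a
      else finSkewSchur (x i) N a b := fun i a b => by
    simp only [hQ, hX]
    split_ifs
    · exact upList_range_apply ..
    · exact downList_range_apply ..
  have hsum : (formalSum fun L : {L : Fin (h + 1) → Ptn // L 0 = L (Fin.last h)} =>
      cylindricTerm s q x N L.1) = trace (diag q * (List.ofFn Q).prod) := by
    have h1 := formalSum_subtype (fun L : Fin (h + 1) → Ptn => L 0 = L (Fin.last h))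
      (fun L => diag q (L 0) (L (Fin.last h)) * ∏ i, Q i (L i.castSucc) (L i.succ))
      fun L hL => by simp [diag, one_apply, hL]
    have h2 : (fun L : {L : Fin (h + 1) → Ptn // L 0 = L (Fin.last h)} =>
        cylindricTerm s q x N L.1) = fun L =>
        diag q (L.1 0) (L.1 (Fin.last h)) * ∏ i, Q i (L.1 i.castSucc) (L.1 i.succ) := by
      ext1 L
      rw [cylindricTerm, diag, one_apply, if_pos L.2, mul_one, L.2]
      simp only [hQ_apply]
    rw [h2, h1, formalSum_path h Q (diag q), trace]
    congr 1
    ext1 a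
    rw [diag_mul_apply, formalSum_eq_single a]
    · simp [diag, one_apply]
    · intro b hb
      simp [diag, one_apply, hb.symm]
  have hgeo : ∀ k, geomSum (q ^ (k + 1)) = geo (q ^ (k + 1)) := fun k =>
    geomSum_eq_geo (by simp [hq0])
  rw [hsum, prod_ofFn_eq, mul_smul_comm, trace_smul, cylindricProd]
  refine CongLE.mul (CongLE.of_eq ?_) ((congLE_trace hq _ _).trans (CongLE.of_eq ?_))
  · refine Finset.prod_congr rfl fun i _ => Finset.prod_congr rfl fun j _ => ?_
    split_ifs with hij
    · simp only [hX, if_pos hij.2.1, if_neg hij.2.2]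
      rw [cauchyProd_reverse_right, cauchyProd_map_range (hx0 i)]
    · rfl
  · refine Finset.prod_congr rfl fun k _ => ?_
    rw [hgeo, List.map_flatten, List.map_ofFn, cauchyProd_ofFn_flatten]
    congr 1
    refine Finset.prod_congr rfl fun i _ => Finset.prod_congr rfl fun j _ => ?_
    by_cases hi : s i <;> by_cases hj : s j
    · simp [hi, hj, cauchyProd]
    · simp only [hX, Function.comp_apply, hi, hj, not_false_eq_true, and_self, if_true, if_false]
      rw [List.map_reverse, cauchyProd_reverse_right, List.map_map, cauchyProd_map_range (hx0 i)]
      rfl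
    · simp [hi, hj, cauchyProd]
    · simp [hi, hj, cauchyProd]

end PtnKernel

/-- The cylindric summation formula in finitely many variables, coefficientwise. -/
theorem hasSum_coeff_cylindricTerm (s : Fin h → Prop) [DecidablePred s]
    {q : MvPowerSeries σ ℕ} {x : Fin h → ℕ → MvPowerSeries σ ℕ}
    (hq0 : constantCoeff q = 0) (hx0 : ∀ i n, constantCoeff (x i n) = 0) {m : σ →₀ ℕ} {K : ℕ}
    (hq : CongLE m (q ^ K) 0) (N : ℕ) :
    HasSum (fun L : {L : Fin (h + 1) → Ptn // L 0 = L (Fin.last h)} =>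
      ((coeff m (cylindricTerm s q x N L.1) : ℕ) : ℚ)) (coeff m (cylindricProd s q x N K) : ℕ) := by
  refine hasSum_natCast_of_ennreal ?_
  set f := Nat.castRingHom ℝ≥0∞
  have := (PtnKernel.congLE_formalSum_cylindricTerm s (q := MvPowerSeries.map f q)
    (x := fun i n => MvPowerSeries.map f (x i n)) (m := m) (K := K) (by simp [hq0])
    (by simp [hx0]) (fun n hn => by simpa [← map_pow] using hq n hn) N).coeff_eq
  rw [← map_cylindricProd, coeff_formalSum] at this
  simp only [← map_cylindricTerm, coeff_map] at this
  exact this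

end Cylindric

section Alphabets

theorem prod_range_mul_eq {R : Type*} [CommMonoid R] (h N : ℕ) (f : ℕ → R) :
    ∏ n ∈ Finset.range (h * N), f n = ∏ i : Fin h, ∏ a ∈ Finset.range N, f (i + h * a) := by
  induction N with
  | zero => simp
  | succ N ih =>
    rw [mul_add, mul_one, Finset.prod_range_add, ih, Finset.prod_range fun i => f (h * N + i)]
    simp only [Finset.prod_range_succ, Finset.prod_mul_distrib, add_comm (h * N)]

theorem exists_forall_le_apply_eq_zero (m : (ℕ × ℕ) ⊕ Unit →₀ ℕ) :
    ∃ N, ∀ i n, N ≤ n → m (Sum.inl (i, n)) = 0 := by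
  refine ⟨m.support.sup (Sum.elim (fun p => p.2 + 1) fun _ => 0), fun i n hn => ?_⟩
  by_contra hm
  have := Finset.le_sup (f := Sum.elim (fun p : ℕ × ℕ => p.2 + 1) fun _ : Unit => 0)
    (Finsupp.mem_support_iff.mpr hm)
  simp only [Sum.elim_inl] at this
  omega

variable {h N : ℕ} {δ : ℕ → ℤ} {m : (ℕ × ℕ) ⊕ Unit →₀ ℕ}

theorem congLE_Za_zero (hN : ∀ i n, N ≤ n → m (Sum.inl (i, n)) = 0) (i n : ℕ) (hn : N ≤ n) :
    CongLE m (Za i n) 0 := by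
  simpa [Za] using congLE_X_pow_zero (R := ℚ) m (Sum.inl (i, n)) (k := 1) (by simp [hN i n hn])

theorem congLE_Zplus_zero (hh : 1 ≤ h) (hN : ∀ i n, N ≤ n → m (Sum.inl (i, n)) = 0) (n : ℕ)
    (hn : h * N ≤ n) : CongLE m (Zplus h δ n) 0 := by
  rw [Zplus]
  split_ifs
  · exact congLE_Za_zero hN _ _ ((Nat.le_div_iff_mul_le hh).mpr (by rwa [mul_comm]))
  · exact CongLE.rfl

theorem congLE_Zminus_zero (hh : 1 ≤ h) (hN : ∀ i n, N ≤ n → m (Sum.inl (i, n)) = 0) (n : ℕ)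
    (hn : h * N ≤ n) : CongLE m (Zminus h δ n) 0 := by
  rw [Zminus]
  split_ifs
  · exact congLE_Za_zero hN _ _ ((Nat.le_div_iff_mul_le hh).mpr (by rwa [mul_comm]))
  · exact CongLE.rfl

theorem vanishesAtTop_Za (i : ℕ) : VanishesAtTop (Za i) := fun m =>
  let ⟨N, hN⟩ := exists_forall_le_apply_eq_zero m
  ⟨N, congLE_Za_zero hN i⟩

theorem vanishesAtTop_Zplus (hh : 1 ≤ h) : VanishesAtTop (Zplus h δ) := fun m =>
  let ⟨N, hN⟩ := exists_forall_le_apply_eq_zero m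
  ⟨h * N, congLE_Zplus_zero hh hN⟩

theorem vanishesAtTop_mul_Zminus (hh : 1 ≤ h) (q : RZ) :
    VanishesAtTop fun n => q * Zminus h δ n := fun m =>
  let ⟨N, hN⟩ := exists_forall_le_apply_eq_zero m
  ⟨h * N, fun n hn => (congLE_Zminus_zero hh hN n hn).mul_zero_right q⟩

theorem constantCoeff_z_pow_succ (k : ℕ) : constantCoeff (z ^ (k + 1)) = 0 := by simp [z]

theorem congLE_z_pow_zero {k : ℕ} (hk : m (Sum.inr ()) < k) : CongLE m (z ^ k) 0 :=
  congLE_X_pow_zero m _ hk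

theorem IsProfile.eq_neg_one_iff (hδ : IsProfile h δ) (i : Fin h) :
    δ (i + 1) = -1 ↔ ¬ δ (i + 1) = 1 := by
  rcases hδ (i + 1) (by omega) (by omega) with hi | hi <;> simp [hi]

theorem IsProfile.gt_iff (hδ : IsProfile h δ) (i j : Fin h) :
    δ (i + 1) > δ (j + 1) ↔ δ (i + 1) = 1 ∧ ¬ δ (j + 1) = 1 := by
  rcases hδ (i + 1) (by omega) (by omega) with hi | hi <;>
  rcases hδ (j + 1) (by omega) (by omega) with hj | hj <;> simp [hi, hj]

theorem congLE_Psi_Zminus_Zplus (hh : 1 ≤ h) (hδ : IsProfile h δ)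
    (hN : ∀ i n, N ≤ n → m (Sum.inl (i, n)) = 0) (k : ℕ) :
    CongLE m (Psi (fun n => z ^ (k + 1) * Zminus h δ n) (Zplus h δ))
      (∏ i : Fin h, ∏ j : Fin h, if δ (i + 1) = 1 ∧ ¬ δ (j + 1) = 1 then
        ∏ a ∈ Finset.range N, ∏ b ∈ Finset.range N,
          geo (Za (i + 1) a * (z ^ (k + 1) * Za (j + 1) b)) else 1) := by
  refine (congLE_Psi (vanishesAtTop_mul_Zminus hh _) (vanishesAtTop_Zplus hh)
    (fun n => by rw [map_mul, constantCoeff_z_pow_succ, zero_mul])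
    (fun n hn => (congLE_Zminus_zero hh hN n hn).mul_zero_right _)
    (congLE_Zplus_zero hh hN)).trans (CongLE.of_eq ?_)
  simp only [prod_range_mul_eq]
  rw [Finset.prod_comm (s := Finset.univ (α := Fin h)) (t := Finset.univ (α := Fin h))]
  refine Finset.prod_congr rfl fun j _ => ?_
  rw [Finset.prod_comm]
  refine Finset.prod_congr rfl fun i _ => ?_
  rw [Finset.prod_comm]
  have hmod : ∀ (i : Fin h) (a : ℕ), (i + h * a) % h = i := fun i a => by
    rw [Nat.add_mul_mod_self_left, Nat.mod_eq_of_lt i.2]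
  have hdiv : ∀ (i : Fin h) (a : ℕ), (i + h * a) / h = a := fun i a => by
    rw [Nat.add_mul_div_left _ _ hh, Nat.div_eq_of_lt i.2, zero_add]
  simp only [Zminus, Zplus, hmod, hdiv, hδ.eq_neg_one_iff]
  by_cases hi : δ (i + 1) = 1 <;> by_cases hj : δ (j + 1) = 1 <;>
    simp [hi, hj, geo_zero, mul_comm]

theorem congLE_cylindricTerm (hN : ∀ i n, N ≤ n → m (Sum.inl (i, n)) = 0)
    (L : Fin (h + 1) → Ptn) :
    CongLE m (z ^ (L (Fin.last h)).size * ∏ i : Fin h,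
        (if δ ((i : ℕ) + 1) = 1 then skewSchur (Za ((i : ℕ) + 1)) (L i.succ) (L i.castSucc)
          else skewSchur (Za ((i : ℕ) + 1)) (L i.castSucc) (L i.succ)))
      (cylindricTerm (fun i : Fin h => δ (i + 1) = 1) z (fun i => Za (i + 1)) N L) := by
  refine CongLE.rfl.mul (CongLE.prod fun i _ => ?_)
  split_ifs <;> exact congLE_skewSchur (vanishesAtTop_Za _) (congLE_Za_zero hN _) _ _

theorem congLE_cylindricProd (hh : 1 ≤ h) (hδ : IsProfile h δ)
    (hN : ∀ i n, N ≤ n → m (Sum.inl (i, n)) = 0) {K : ℕ} (hK : m (Sum.inr ()) < K) :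
    CongLE m ((∏ q ∈ Finset.univ.filter
          (fun q : Fin h × Fin h => q.1 < q.2 ∧ δ ((q.1 : ℕ) + 1) > δ ((q.2 : ℕ) + 1)),
          Psi (Za ((q.1 : ℕ) + 1)) (Za ((q.2 : ℕ) + 1))) *
        ∏' k : ℕ, Psi (fun n => z ^ (k + 1) * Zminus h δ n) (Zplus h δ) * (1 - z ^ (k + 1))⁻¹)
      (cylindricProd (fun i : Fin h => δ (i + 1) = 1) z (fun i => Za (i + 1)) N K) := by
  refine CongLE.mul ?_ ?_
  · rw [Finset.prod_filter, Fintype.prod_prod_type]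
    refine CongLE.prod fun i _ => CongLE.prod fun j _ => ?_
    simp only [hδ.gt_iff]
    split_ifs
    · exact congLE_Psi (vanishesAtTop_Za _) (vanishesAtTop_Za _) (fun n => by simp [Za])
        (congLE_Za_zero hN _) (congLE_Za_zero hN _)
    · exact CongLE.rfl
  · have hfactor : ∀ {m : (ℕ × ℕ) ⊕ Unit →₀ ℕ} (k : ℕ), k ∉ Finset.range (m (Sum.inr ())) →
        CongLE m (Psi (fun n => z ^ (k + 1) * Zminus h δ n) (Zplus h δ) * (1 - z ^ (k + 1))⁻¹)
          1 := fun {m} k hk => by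
      have hz : CongLE m (z ^ (k + 1)) 0 :=
        congLE_z_pow_zero (Nat.lt_succ_of_le (by simpa using hk))
      obtain ⟨N, hN⟩ := exists_forall_le_apply_eq_zero m
      have hPsi := congLE_Psi (m := m) (M := 0) (vanishesAtTop_mul_Zminus (δ := δ) hh (z ^ (k + 1)))
        (vanishesAtTop_Zplus (δ := δ) hh)
        (fun n => by rw [map_mul, constantCoeff_z_pow_succ, zero_mul])
        (fun n _ => hz.mul_zero_left _) (congLE_Zplus_zero hh hN)
      rw [inv_one_sub_eq_geo (constantCoeff_z_pow_succ k)]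
      simpa using hPsi.mul (congLE_geo_one hz)
    refine (congLE_tprod (fun m => ⟨_, hfactor⟩) (Finset.range K)
      fun k hk => hfactor k fun hk' => hk ?_).trans (CongLE.prod fun k _ => ?_)
    · simp only [Finset.mem_range] at hk' ⊢
      omega
    · rw [inv_one_sub_eq_geo (constantCoeff_z_pow_succ k)]
      exact (congLE_Psi_Zminus_Zplus hh hδ hN k).mul CongLE.rfl

end Alphabets

/-- **Cylindric summation formula in profile form** (Theorem 2.1, equation (2.3)):
for a profile `δ = (δ_1, …, δ_h)`,
`Σ_{λ^0=λ^h} z^{|λ^h|} ∏_{i=1}^h s_i^δ(Z^i)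
  = ∏_{1≤i<j≤h, δ_i>δ_j} Ψ(Z^i,Z^j) · ∏_{k≥1} Ψ(z^k Z^δ_-, Z^δ_+)/(1-z^k)`,
where `s_i^δ = s_{λ^i/λ^{i-1}}` if `δ_i = 1` and `s_{λ^{i-1}/λ^i}` if `δ_i = -1`. -/
theorem cylindric_summation_formula_profile (h : ℕ) (hh : 1 ≤ h) (δ : ℕ → ℤ)
    (hδ : IsProfile h δ) :
    ∑' L : {L : Fin (h + 1) → Ptn // L 0 = L (Fin.last h)},
      z ^ (L.1 (Fin.last h)).size *
        ∏ i : Fin h,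
          (if δ ((i : ℕ) + 1) = 1 then skewSchur (Za ((i : ℕ) + 1)) (L.1 i.succ) (L.1 i.castSucc)
            else skewSchur (Za ((i : ℕ) + 1)) (L.1 i.castSucc) (L.1 i.succ))
    = (∏ q ∈ Finset.univ.filter
          (fun q : Fin h × Fin h => q.1 < q.2 ∧ δ ((q.1 : ℕ) + 1) > δ ((q.2 : ℕ) + 1)),
          Psi (Za ((q.1 : ℕ) + 1)) (Za ((q.2 : ℕ) + 1))) *
        ∏' k : ℕ,
          Psi (fun n => z ^ (k + 1) * Zminus h δ n) (Zplus h δ) * (1 - z ^ (k + 1))⁻¹ := by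
  refine (hasSum_iff_coeff.mpr fun m => ?_).tsum_eq
  obtain ⟨N, hN⟩ := exists_forall_le_apply_eq_zero m
  have hK := Nat.lt_succ_self (m (Sum.inr ()))
  rw [(congLE_cylindricProd hh hδ hN hK).coeff_eq]
  simp only [fun L => (congLE_cylindricTerm (h := h) (δ := δ) hN L).coeff_eq]
  have key := hasSum_coeff_cylindricTerm (fun i : Fin h => δ (i + 1) = 1)
    (q := MvPowerSeries.X (Sum.inr ())) (x := fun i n => MvPowerSeries.X (Sum.inl ((i : ℕ) + 1, n)))
    (m := m) (K := m (Sum.inr ()) + 1) (by simp) (by simp) (congLE_X_pow_zero m _ hK) N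
  have hz : z = MvPowerSeries.map (Nat.castRingHom ℚ) (MvPowerSeries.X (Sum.inr ())) :=
    (MvPowerSeries.map_X _ _).symm
  have hZa : (fun i : Fin h => Za (i + 1)) = fun (i : Fin h) (n : ℕ) =>
      MvPowerSeries.map (Nat.castRingHom ℚ) (MvPowerSeries.X (Sum.inl ((i : ℕ) + 1, n))) :=
    funext₂ fun i n => (MvPowerSeries.map_X _ _).symm
  rw [hz, hZa]
  simp only [← map_cylindricTerm, ← map_cylindricProd, coeff_map]
  exact key
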